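/- Let n ≥ 1 and let p₁,…,pₙ ∈ ℂ[x₁,…,xₙ,u] be nonzero irreducible polynomials, each of degree at least 1 in u and none of the form c·u for a constant c. Let V be an irreducible component of the algebraic set {(x̄, ȳ) ∈ ℂ^n × (ℂ*)^n : pᵢ(x̄, yᵢ) = 0 for all i = 1,…,n}. Assume the projection π₁(V) of V to the first n coordinates is Zariski dense in ℂ^n. Then the set {ā ∈ ℂ^n : (ā, e^{ā}) ∈ V} is Zariski dense in ℂ^n. -/

import Mathlib

open MvPolynomial Complex

/-- The common zero set in `ℂ^σ` of a family of polynomials. -/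
def zeroSet {σ : Type} (T : Set (MvPolynomial σ ℂ)) : Set (σ → ℂ) :=
  {x | ∀ p ∈ T, eval x p = 0}

/-- A subset of `ℂ^σ` is Zariski closed if it is the common zero set of a
family of polynomials. -/
def IsZClosed {σ : Type} (s : Set (σ → ℂ)) : Prop :=
  ∃ T : Set (MvPolynomial σ ℂ), s = zeroSet T

/-- The Zariski closure of a subset of `ℂ^σ`. -/
def zClosure {σ : Type} (s : Set (σ → ℂ)) : Set (σ → ℂ) :=
  ⋂₀ {c : Set (σ → ℂ) | IsZClosed c ∧ s ⊆ c}

/-- A subset of `ℂ^σ` is Zariski dense if the only polynomial vanishing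
identically on it is the zero polynomial. -/
def IsZDense {σ : Type} (s : Set (σ → ℂ)) : Prop :=
  ∀ p : MvPolynomial σ ℂ, (∀ x ∈ s, eval x p = 0) → p = 0

/-- A subset of `ℂ^σ` is irreducible (for the Zariski topology). -/
def IsZIrreducible {σ : Type} (s : Set (σ → ℂ)) : Prop :=
  s.Nonempty ∧ ∀ c₁ c₂ : Set (σ → ℂ), IsZClosed c₁ → IsZClosed c₂ →
    s ⊆ c₁ ∪ c₂ → s ⊆ c₁ ∨ s ⊆ c₂

/-- The dimension of a subset of `ℂ^σ`: the Krull dimension of its Zariski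
closure, i.e. the Krull dimension of the poset of irreducible Zariski closed
subsets of the closure (`⊥ = -1` for the empty set). -/
noncomputable def zdim {σ : Type} (s : Set (σ → ℂ)) : WithBot ℕ∞ :=
  Order.krullDim {t : Set (σ → ℂ) // IsZClosed t ∧ IsZIrreducible t ∧ t ⊆ zClosure s}

/-- Constructible subsets of `ℂ^σ`: finite Boolean combinations of Zariski
closed sets. -/
inductive IsZConstructible {σ : Type} : Set (σ → ℂ) → Prop
  | of_closed (s : Set (σ → ℂ)) : IsZClosed s → IsZConstructible s
  | compl (s : Set (σ → ℂ)) : IsZConstructible s → IsZConstructible sᶜ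
  | union (s t : Set (σ → ℂ)) : IsZConstructible s → IsZConstructible t →
      IsZConstructible (s ∪ t)

/-- "The transcendence degree of `K(s)` over `K` is at least `r`":
there are `r` elements of `s` that are algebraically independent over `K`. -/
def TrdegGe (K : Type) [Field K] [Algebra K ℂ] (s : Set ℂ) (r : ℕ) : Prop :=
  ∃ t : Finset ℂ, ↑t ⊆ s ∧ t.card = r ∧
    AlgebraicIndependent K (Subtype.val : ↥(t : Set ℂ) → ℂ)

/-- "The transcendence degree of `K(s)` over `K` equals `m`": there is a
transcendence basis of `K(s)` over `K` consisting of `m` elements of `s`. -/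
def TrdegEq (K : Type) [Field K] [Algebra K ℂ] (s : Set ℂ) (m : ℕ) : Prop :=
  ∃ t : Finset ℂ, ↑t ⊆ s ∧ t.card = m ∧
    AlgebraicIndependent K (Subtype.val : ↥(t : Set ℂ) → ℂ) ∧
    ∀ x ∈ s, IsAlgebraic (↥(IntermediateField.adjoin K (t : Set ℂ))) x

/-- Schanuel's Conjecture: the transcendence degree over `ℚ` of
`ℚ(z₁,…,zₙ,e^{z₁},…,e^{zₙ})` is at least the dimension of the `ℚ`-vector
space spanned by `z₁,…,zₙ`. -/
def SchanuelConjecture : Prop :=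
  ∀ (n : ℕ) (z : Fin n → ℂ),
    TrdegGe ℚ (Set.range z ∪ Set.range fun i => exp (z i))
      (Module.finrank ℚ ↥(Submodule.span ℚ (Set.range z)))

/-- A holomorphic map `L` on a ball whose components have bounded real part, with radius large
compared to that bound, gives a solution of `a = c + L a`. -/
theorem exists_eq_center_add {n : ℕ} {c : Fin n → ℂ} {R A A' : ℝ} (hA : 0 < A) (hA' : 0 ≤ A')
    {L : (Fin n → ℂ) → Fin n → ℂ} (hL : DifferentiableOn ℂ L (Metric.ball c R))
    (hre : ∀ x ∈ Metric.ball c R, ∀ i, (L x i).re ≤ A) (hc : ∀ i, ‖L c i‖ ≤ A')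
    (hR : 16 * (2 * A + 3 * A') ≤ R) :
    ∃ a ∈ Metric.ball c R, a = c + L a := by
  set M := 2 * A + 3 * A' with hM
  have hMpos : 0 < M := by positivity
  have hRpos : 0 < R := by linarith
  have hbound : ∀ x ∈ Metric.ball c (R / 2), ‖L x‖ ≤ M := by
    intro x hx
    rw [pi_norm_le_iff_of_nonneg hMpos.le]
    intro i
    rw [mem_ball_iff_norm] at hx
    have hmaps : Set.MapsTo (fun s : ℂ => c + s • (x - c)) (Metric.ball 0 2) (Metric.ball c R) := by
      intro s hs
      rw [mem_ball_zero_iff] at hs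
      rw [mem_ball_iff_norm, add_sub_cancel_left, norm_smul]
      nlinarith [norm_nonneg s, norm_nonneg (x - c)]
    have hd : DifferentiableOn ℂ (fun s : ℂ => L (c + s • (x - c)) i) (Metric.ball 0 2) := by
      have h1 : DifferentiableOn ℂ (fun s : ℂ => L (c + s • (x - c))) (Metric.ball 0 2) :=
        hL.comp (f := fun s : ℂ => c + s • (x - c)) (by fun_prop) hmaps
      exact (differentiableOn_pi.1 h1) i
    have := Complex.borelCaratheodory (z := 1) hA hd (fun s hs => hre _ (hmaps hs) i) (by norm_num)
      (by simp)
    norm_num at this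
    linarith [hc i]
  have hlip : ∀ x ∈ Metric.closedBall c (R / 8), ∀ y ∈ Metric.closedBall c (R / 8),
      dist (L x) (L y) ≤ 1 / 2 * dist x y := by
    intro x hx y hy
    have hsub : Metric.ball y (3 * R / 8) ⊆ Metric.ball c (R / 2) := by
      apply Metric.ball_subset_ball'
      rw [Metric.mem_closedBall] at hy
      linarith
    have hmaps : Set.MapsTo L (Metric.ball y (3 * R / 8)) (Metric.closedBall (L y) (2 * M)) := by
      intro z hz
      rw [mem_closedBall_iff_norm]
      have h1 := hbound z (hsub hz)
      have h2 := hbound y (hsub (Metric.mem_ball_self (by positivity)))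
      exact (norm_sub_le _ _).trans (by linarith)
    have hxy : x ∈ Metric.ball y (3 * R / 8) := by
      rw [Metric.mem_closedBall] at hx hy
      rw [Metric.mem_ball]
      linarith [dist_triangle_right x y c]
    have := Complex.dist_le_div_mul_dist_of_mapsTo_ball
      (hL.mono (hsub.trans (Metric.ball_subset_ball (by linarith)))) hmaps hxy
    refine this.trans ?_
    refine mul_le_mul_of_nonneg_right ?_ dist_nonneg
    rw [div_le_div_iff₀ (by positivity) (by norm_num)]
    linarith
  have hmaps : Set.MapsTo (fun x => c + L x) (Metric.closedBall c (R / 8))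
      (Metric.closedBall c (R / 8)) := by
    intro x hx
    rw [mem_closedBall_iff_norm, add_sub_cancel_left]
    exact (hbound x (Metric.closedBall_subset_ball (by linarith) hx)).trans (by linarith)
  have hcontr : ContractingWith (1 / 2) (hmaps.restrict _ _ _) := by
    refine ⟨by rw [← NNReal.coe_lt_coe]; norm_num, LipschitzWith.of_dist_le_mul ?_⟩
    rintro ⟨x, hx⟩ ⟨y, hy⟩
    simpa [Subtype.dist_eq] using hlip x hx y hy
  obtain ⟨a, ha, hfix, -⟩ := hcontr.exists_fixedPoint' Metric.isClosed_closedBall.isComplete hmaps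
    (Metric.mem_closedBall_self (by positivity)) (edist_ne_top _ _)
  exact ⟨a, Metric.closedBall_subset_ball (by linarith) ha, hfix.symm⟩

/-- Substitution of `x` for the coefficient variables and of `T` for the polynomial variable. -/
noncomputable def evalAt {n : ℕ} (x : Fin n → ℂ) (T : ℂ) :
    Polynomial (MvPolynomial (Fin n) ℂ) →+* ℂ :=
  Polynomial.eval₂RingHom (MvPolynomial.eval x) T

theorem evalAt_eq_eval_map {n : ℕ} (x : Fin n → ℂ) (T : ℂ)
    (h : Polynomial (MvPolynomial (Fin n) ℂ)) :
    evalAt x T h = (h.map (MvPolynomial.eval x)).eval T := by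
  simp [evalAt, Polynomial.eval_map]

@[simp] theorem evalAt_C {n : ℕ} (x : Fin n → ℂ) (T : ℂ) (f : MvPolynomial (Fin n) ℂ) :
    evalAt x T (Polynomial.C f) = MvPolynomial.eval x f := by
  simp [evalAt]

@[simp] theorem evalAt_X {n : ℕ} (x : Fin n → ℂ) (T : ℂ) :
    evalAt x T Polynomial.X = T := by
  simp [evalAt]

theorem MvPolynomial.contDiff_eval {n : ℕ} (f : MvPolynomial (Fin n) ℂ) :
    ContDiff ℂ 1 (fun x : Fin n → ℂ => MvPolynomial.eval x f) := by
  induction f using MvPolynomial.induction_on with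
  | C a => simpa using contDiff_const
  | add p q hp hq => simpa using hp.add hq
  | mul_X p i hp => simpa using hp.mul (contDiff_apply ℂ ℂ i)

theorem contDiff_evalAt {n : ℕ} (h : Polynomial (MvPolynomial (Fin n) ℂ)) :
    ContDiff ℂ 1 (fun v : (Fin n → ℂ) × ℂ => evalAt v.1 v.2 h) := by
  induction h using Polynomial.induction_on' with
  | add p q hp hq => simpa using hp.add hq
  | monomial k a =>
    simpa [← Polynomial.C_mul_X_pow_eq_monomial] using
      (a.contDiff_eval.comp contDiff_fst).mul (contDiff_snd.pow k)

theorem hasDerivAt_evalAt {n : ℕ} (h : Polynomial (MvPolynomial (Fin n) ℂ)) (x : Fin n → ℂ)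
    (T : ℂ) : HasDerivAt (fun T => evalAt x T h) (evalAt x T (Polynomial.derivative h)) T := by
  simp only [evalAt_eq_eval_map, ← Polynomial.derivative_map]
  exact Polynomial.hasDerivAt _ _

theorem Polynomial.Monic.norm_le_add_norm_eval {p : Polynomial ℂ} (hp : p.Monic)
    (hdeg : 0 < p.natDegree) (z : ℂ) :
    ‖z‖ ≤ 1 + ∑ i ∈ Finset.range p.natDegree, ‖p.coeff i‖ + ‖p.eval z‖ := by
  obtain ⟨d, hd⟩ : ∃ d, p.natDegree = d + 1 := ⟨p.natDegree - 1, by omega⟩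
  have hS : 0 ≤ ∑ i ∈ Finset.range p.natDegree, ‖p.coeff i‖ :=
    Finset.sum_nonneg fun _ _ => norm_nonneg _
  rcases le_or_gt ‖z‖ 1 with h1 | h1
  · linarith [norm_nonneg (p.eval z)]
  have heq : z ^ (d + 1) = p.eval z - ∑ i ∈ Finset.range p.natDegree, p.coeff i * z ^ i := by
    rw [Polynomial.eval_eq_sum_range, Finset.sum_range_succ, hp.coeff_natDegree, hd]
    ring
  have hle : ‖z‖ ^ d * ‖z‖ ≤
      ‖z‖ ^ d * (‖p.eval z‖ + ∑ i ∈ Finset.range p.natDegree, ‖p.coeff i‖) := by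
    rw [← pow_succ, ← norm_pow, heq, mul_add, Finset.mul_sum]
    refine (norm_sub_le _ _).trans (add_le_add ?_ ((norm_sum_le _ _).trans ?_))
    · exact le_mul_of_one_le_left (norm_nonneg _) (one_le_pow₀ h1.le)
    · refine Finset.sum_le_sum fun i hi => ?_
      rw [norm_mul, norm_pow, mul_comm]
      have : i ≤ d := by rw [Finset.mem_range] at hi; omega
      gcongr
      exact h1.le
  linarith [le_of_mul_le_mul_left hle (by positivity)]

theorem isSimplyConnected_ball {n : ℕ} (c : Fin n → ℂ) {R : ℝ} (hR : 0 < R) :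
    IsSimplyConnected (Metric.ball c R) := by
  have := (convex_ball c R).contractibleSpace ⟨c, Metric.mem_ball_self hR⟩
  exact (SimplyConnectedSpace.ofContractible _ : SimplyConnectedSpace (Metric.ball c R))

theorem isClosedMap_prod_evalAt {n : ℕ} {g : Polynomial (MvPolynomial (Fin n) ℂ)} (hg : g.Monic)
    (hdeg : 0 < g.natDegree) :
    IsClosedMap (fun v : (Fin n → ℂ) × ℂ => (evalAt v.1 v.2 g, v.1)) := by
  have hcont : Continuous (fun v : (Fin n → ℂ) × ℂ => (evalAt v.1 v.2 g, v.1)) :=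
    (contDiff_evalAt g).continuous.prodMk continuous_fst
  refine (isProperMap_iff_isCompact_preimage.2 ⟨hcont, fun K hK => ?_⟩).isClosedMap
  let b : ℂ × (Fin n → ℂ) → ℝ := fun w =>
    1 + ∑ i ∈ Finset.range g.natDegree, ‖MvPolynomial.eval w.2 (g.coeff i)‖ + ‖w.1‖
  have hb : Continuous b := by
    have := fun i => (g.coeff i).contDiff_eval.continuous
    fun_prop
  obtain ⟨B, hB⟩ := (hK.image hb).bddAbove
  refine ((hK.image continuous_snd).prod (isCompact_closedBall (0 : ℂ) B)).of_isClosed_subset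
    (hK.isClosed.preimage hcont) ?_
  rintro ⟨x, T⟩ hv
  refine ⟨⟨_, hv, rfl⟩, mem_closedBall_zero_iff.2 (le_trans ?_ (hB ⟨_, hv, rfl⟩))⟩
  have h1 := (hg.map (MvPolynomial.eval x)).norm_le_add_norm_eval
    (by rwa [hg.natDegree_map]) T
  simpa [b, hg.natDegree_map, evalAt_eq_eval_map] using h1

theorem isInvertible_fderiv_evalAt {n : ℕ} {g : Polynomial (MvPolynomial (Fin n) ℂ)}
    {u : (Fin n → ℂ) × ℂ} (hu : evalAt u.1 u.2 (Polynomial.derivative g) ≠ 0) :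
    (fderiv ℂ (fun v : (Fin n → ℂ) × ℂ => evalAt v.1 v.2 g) u ∘L
      .inr ℂ (Fin n → ℂ) ℂ).IsInvertible := by
  have h1 : HasFDerivAt (fun T => evalAt u.1 T g)
      (fderiv ℂ (fun v : (Fin n → ℂ) × ℂ => evalAt v.1 v.2 g) u ∘L .inr ℂ (Fin n → ℂ) ℂ) u.2 := by
    have := ((contDiff_evalAt g).differentiable one_ne_zero u).hasFDerivAt
    exact HasFDerivAt.comp (g := fun v : (Fin n → ℂ) × ℂ => evalAt v.1 v.2 g)
      (f := fun T => (u.1, T)) u.2 this (hasFDerivAt_prodMk_right u.1 u.2)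
  have h2 := h1.unique (hasDerivAt_evalAt g u.1 u.2).hasFDerivAt
  rw [h2]
  exact ⟨ContinuousLinearEquiv.unitsEquivAut ℂ (Units.mk0 _ hu), by ext; simp⟩

theorem exists_differentiableOn_root {n : ℕ} {g : Polynomial (MvPolynomial (Fin n) ℂ)}
    (hg : g.Monic) (hdeg : 0 < g.natDegree) {c : Fin n → ℂ} {R : ℝ} (hR : 0 < R)
    (hsep : ∀ x ∈ Metric.ball c R, ∀ T, evalAt x T g = 0 →
      evalAt x T (Polynomial.derivative g) ≠ 0) :
    ∃ θ : (Fin n → ℂ) → ℂ, DifferentiableOn ℂ θ (Metric.ball c R) ∧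
      ∀ x ∈ Metric.ball c R, evalAt x (θ x) g = 0 := by
  classical
  set Ψ : (Fin n → ℂ) × ℂ → ℂ × (Fin n → ℂ) := fun v => (evalAt v.1 v.2 g, v.1) with hΨ
  set s : Set (ℂ × (Fin n → ℂ)) := {0} ×ˢ Metric.ball c R with hs
  have hcov : IsCoveringMapOn Ψ s := by
    refine (isClosedMap_prod_evalAt hg hdeg).isCoveringMapOn_of_isLocalHomeomorphOn ?_ ?_
    · rintro ⟨w, x⟩ ⟨hw, hx⟩
      have hw' : w = 0 := hw
      subst hw'
      have hne : g.map (MvPolynomial.eval x) ≠ 0 := (hg.map _).ne_zero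
      refine ((Polynomial.finite_setOfPred_isRoot hne).image (fun T => (x, T))).subset ?_
      rintro ⟨x', T⟩ hv
      simp only [Set.mem_preimage, Set.mem_singleton_iff, Prod.mk.injEq] at hv
      obtain ⟨hv, rfl⟩ := hv
      exact ⟨T, by simpa [Polynomial.IsRoot, evalAt_eq_eval_map] using hv, rfl⟩
    · rintro ⟨x, T⟩ ⟨hw, hx⟩
      have hinv := isInvertible_fderiv_evalAt (g := g) (u := (x, T)) (hsep x hx T hw)
      have hstr := (contDiff_evalAt g).contDiffAt.hasStrictFDerivAt (x := (x, T)) one_ne_zero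
      let φ := hstr.implicitFunctionDataOfProdDomain hinv
      exact ⟨φ.toOpenPartialHomeomorph, φ.pt_mem_toOpenPartialHomeomorph_source, rfl⟩
  have := (isSimplyConnected_ball c hR).simplyConnectedSpace
  have := (Metric.isOpen_ball (x := c) (ε := R)).locallyPathConnectedSpace
  have hdeg' : (g.map (MvPolynomial.eval c)).degree ≠ 0 := by
    rw [hg.degree_map, Polynomial.degree_eq_natDegree hg.ne_zero]
    exact_mod_cast hdeg.ne'
  obtain ⟨T₀, hT₀⟩ := IsAlgClosed.exists_root _ hdeg'
  obtain ⟨F, ⟨-, hF⟩, -⟩ := hcov.existsUnique_continuousMap_lifts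
    (A := Metric.ball c R) ⟨fun x => (0, x.1), by fun_prop⟩ (a₀ := ⟨c, Metric.mem_ball_self hR⟩)
    (e₀ := (c, T₀)) (by simpa [hΨ, evalAt_eq_eval_map] using hT₀) (fun x => ⟨rfl, x.2⟩)
  have hF' : ∀ x : Metric.ball c R, (F x).1 = x ∧ evalAt x (F x).2 g = 0 := by
    intro x
    have := congrFun hF x
    simp only [hΨ, Function.comp_apply, ContinuousMap.coe_mk, Prod.mk.injEq] at this
    exact ⟨this.2, this.2 ▸ this.1⟩
  set θ : (Fin n → ℂ) → ℂ := fun x => if hx : x ∈ Metric.ball c R then (F ⟨x, hx⟩).2 else 0 with hθ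
  have hroot : ∀ x ∈ Metric.ball c R, evalAt x (θ x) g = 0 := by
    intro x hx
    simpa only [hθ, dif_pos hx] using (hF' ⟨x, hx⟩).2
  refine ⟨θ, ?_, hroot⟩
  have hcont : ContinuousOn θ (Metric.ball c R) := by
    rw [continuousOn_iff_continuous_domRestrict]
    convert! continuous_snd.comp (map_continuous F) with x
    ext x
    exact dif_pos x.2
  intro x hx
  apply DifferentiableAt.differentiableWithinAt
  have hnhds := Metric.isOpen_ball.mem_nhds hx
  have hcd : ContDiffAt ℂ 1 (fun v : (Fin n → ℂ) × ℂ => evalAt v.1 v.2 g) (x, θ x) :=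
    (contDiff_evalAt g).contDiffAt
  have hinv := isInvertible_fderiv_evalAt (g := g) (u := (x, θ x)) (hsep x hx _ (hroot x hx))
  have hdiff := (hcd.contDiffAt_implicitFunction one_ne_zero hinv).differentiableAt one_ne_zero
  refine hdiff.congr_of_eventuallyEq ?_
  have htend : Filter.Tendsto (fun z => (z, θ z)) (nhds x) (nhds (x, θ x)) :=
    Filter.Tendsto.prodMk_nhds Filter.tendsto_id (hcont.continuousAt hnhds)
  filter_upwards [htend.eventually (hcd.eventually_apply_eq_iff_implicitFunction one_ne_zero hinv),
    hnhds] with z hz hzb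
  exact (hz.1 (by simp only [hroot z hzb, hroot x hx])).symm

theorem exists_differentiableOn_log {n : ℕ} {c : Fin n → ℂ} {R : ℝ} (hR : 0 < R)
    {y : (Fin n → ℂ) → ℂ} (hy : DifferentiableOn ℂ y (Metric.ball c R))
    (hy0 : ∀ x ∈ Metric.ball c R, y x ≠ 0) :
    ∃ L : (Fin n → ℂ) → ℂ, DifferentiableOn ℂ L (Metric.ball c R) ∧
      (∀ x ∈ Metric.ball c R, exp (L x) = y x) ∧ |(L c).im| ≤ Real.pi := by
  obtain ⟨L, hLc, hL⟩ := Complex.exists_continuousOn_eqOn_exp_comp (isSimplyConnected_ball c hR)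
    Metric.isOpen_ball hy.continuousOn (by rintro ⟨x, hx, h⟩; exact hy0 x hx h)
  have hL' : ∀ x ∈ Metric.ball c R, exp (L x) = y x := fun x hx => hL hx
  have hcR := Metric.mem_ball_self (x := c) hR
  have hdiff : DifferentiableOn ℂ L (Metric.ball c R) := by
    intro x hx
    apply DifferentiableAt.differentiableWithinAt
    have hnhds := Metric.isOpen_ball.mem_nhds hx
    have hd : DifferentiableAt ℂ (fun z => log (y z / y x) + L x) x := by
      have h1 : DifferentiableAt ℂ (fun z => y z / y x) x := by
        simpa only [div_eq_mul_inv] using (hy.differentiableAt hnhds).mul_const _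
      exact (h1.clog (by rw [div_self (hy0 x hx)]; simp)).add_const _
    refine hd.congr_of_eventuallyEq ?_
    have hcx := hLc.continuousAt hnhds
    have him : Filter.Tendsto (fun z => (L z - L x).im) (nhds x) (nhds 0) := by
      have : ContinuousAt (fun z => (L z - L x).im) x :=
        Complex.continuous_im.continuousAt.comp (hcx.sub continuousAt_const)
      simpa [ContinuousAt] using this
    filter_upwards [hnhds, him.eventually (Ioo_mem_nhds (neg_lt_zero.2 Real.pi_pos) Real.pi_pos)]
      with z hz hzi
    rw [← hL' z hz, ← hL' x hx, ← exp_sub, log_exp hzi.1 hzi.2.le]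
    ring
  refine ⟨fun x => L x - L c + log (y c), by fun_prop, fun x hx => ?_, ?_⟩
  · rw [exp_add, exp_sub, exp_log (hy0 c hcR), hL' x hx, hL' c hcR]
    field_simp [hy0 c hcR]
  · simpa using abs_le.2 ⟨(neg_pi_lt_log_im (y c)).le, log_im_le_pi _⟩

theorem MvPolynomial.exists_norm_eval_le {n : ℕ} (f : MvPolynomial (Fin n) ℂ) :
    ∃ C : ℝ, 0 ≤ C ∧ ∃ M : ℕ, ∀ x : Fin n → ℂ, ‖eval x f‖ ≤ C * (1 + ‖x‖) ^ M := by
  induction f using MvPolynomial.induction_on with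
  | C a => exact ⟨‖a‖, norm_nonneg a, 0, fun x => by simp⟩
  | add p q hp hq =>
    obtain ⟨C₁, h₁, M₁, H₁⟩ := hp
    obtain ⟨C₂, h₂, M₂, H₂⟩ := hq
    refine ⟨C₁ + C₂, by positivity, M₁ + M₂, fun x => ?_⟩
    have hx : 1 ≤ 1 + ‖x‖ := by linarith [norm_nonneg x]
    rw [map_add, add_mul]
    refine (norm_add_le _ _).trans (add_le_add ((H₁ x).trans ?_) ((H₂ x).trans ?_))
    · gcongr
      omega
    · gcongr
      omega
  | mul_X p i hp =>
    obtain ⟨C₁, h₁, M₁, H₁⟩ := hp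
    refine ⟨C₁, h₁, M₁ + 1, fun x => ?_⟩
    rw [map_mul, eval_X, norm_mul, pow_succ, ← mul_assoc]
    gcongr
    · exact H₁ x
    · linarith [norm_le_pi_norm x i]

theorem exists_norm_root_le {n : ℕ} {g : Polynomial (MvPolynomial (Fin n) ℂ)} (hg : g.Monic)
    (hdeg : 0 < g.natDegree) :
    ∃ C : ℝ, 0 ≤ C ∧ ∃ M : ℕ, ∀ (x : Fin n → ℂ) (T : ℂ), evalAt x T g = 0 →
      ‖T‖ ≤ C * (1 + ‖x‖) ^ M := by
  choose C hC M hM using fun f : MvPolynomial (Fin n) ℂ => f.exists_norm_eval_le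
  refine ⟨1 + ∑ i ∈ Finset.range g.natDegree, C (g.coeff i),
    add_nonneg zero_le_one (Finset.sum_nonneg fun _ _ => hC _),
    ∑ i ∈ Finset.range g.natDegree, M (g.coeff i), fun x T hT => ?_⟩
  have hx : 1 ≤ 1 + ‖x‖ := by linarith [norm_nonneg x]
  have h1 := (hg.map (MvPolynomial.eval x)).norm_le_add_norm_eval
    (by rwa [hg.natDegree_map]) T
  rw [← evalAt_eq_eval_map, hT, norm_zero, add_zero, hg.natDegree_map] at h1
  refine h1.trans ?_
  rw [add_mul, one_mul, Finset.sum_mul]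
  refine add_le_add (one_le_pow₀ hx) (Finset.sum_le_sum fun i hi => ?_)
  rw [Polynomial.coeff_map]
  refine (hM (g.coeff i) x).trans ?_
  gcongr
  · exact hC _
  · exact Finset.single_le_sum (f := fun i => M (g.coeff i)) (fun _ _ => Nat.zero_le _) hi

theorem exists_norm_evalAt_le {n : ℕ} {g : Polynomial (MvPolynomial (Fin n) ℂ)} (hg : g.Monic)
    (hdeg : 0 < g.natDegree) (h : Polynomial (MvPolynomial (Fin n) ℂ)) :
    ∃ C : ℝ, 0 ≤ C ∧ ∃ M : ℕ, ∀ (x : Fin n → ℂ) (T : ℂ), evalAt x T g = 0 →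
      ‖evalAt x T h‖ ≤ C * (1 + ‖x‖) ^ M := by
  induction h using Polynomial.induction_on' with
  | add p q hp hq =>
    obtain ⟨C₁, h₁, M₁, H₁⟩ := hp
    obtain ⟨C₂, h₂, M₂, H₂⟩ := hq
    refine ⟨C₁ + C₂, by positivity, M₁ + M₂, fun x T hT => ?_⟩
    have hx : 1 ≤ 1 + ‖x‖ := by linarith [norm_nonneg x]
    rw [map_add, add_mul]
    refine (norm_add_le _ _).trans (add_le_add ((H₁ x T hT).trans ?_) ((H₂ x T hT).trans ?_))
    · gcongr
      omega
    · gcongr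
      omega
  | monomial k a =>
    obtain ⟨C₁, h₁, M₁, H₁⟩ := a.exists_norm_eval_le
    obtain ⟨C₂, h₂, M₂, H₂⟩ := exists_norm_root_le hg hdeg
    refine ⟨C₁ * C₂ ^ k, by positivity, M₁ + M₂ * k, fun x T hT => ?_⟩
    rw [← Polynomial.C_mul_X_pow_eq_monomial, map_mul, map_pow, evalAt_C, evalAt_X, norm_mul,
      norm_pow]
    calc _ ≤ (C₁ * (1 + ‖x‖) ^ M₁) * (C₂ * (1 + ‖x‖) ^ M₂) ^ k := by
          gcongr
          · exact H₁ x
          · exact H₂ x T hT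
      _ = _ := by ring

theorem MvPolynomial.IsHomogeneous.eval_smul {n m : ℕ} {f : MvPolynomial (Fin n) ℂ}
    (hf : f.IsHomogeneous m) (t : ℂ) (x : Fin n → ℂ) : eval (t • x) f = t ^ m * eval x f := by
  rw [eval_eq', eval_eq', Finset.mul_sum]
  refine Finset.sum_congr rfl fun d hd => ?_
  have hdm : ∑ i, d i = m := by
    rw [← Finsupp.degree_eq_sum, Finsupp.degree_eq_weight_one]
    exact hf (mem_support_iff.1 hd)
  simp only [Pi.smul_apply, smul_eq_mul, mul_pow, Finset.prod_mul_distrib]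
  rw [Finset.prod_pow_eq_pow_sum, hdm]
  ring

theorem MvPolynomial.homogeneousComponent_totalDegree_ne_zero {n : ℕ} {f : MvPolynomial (Fin n) ℂ}
    (hf : f ≠ 0) : homogeneousComponent f.totalDegree f ≠ 0 := by
  obtain ⟨d, hd, hdeg⟩ := Finset.exists_mem_eq_sup f.support (support_nonempty.2 hf)
    (fun s => s.sum fun _ e => e)
  intro h
  have := congrArg (coeff d) h
  rw [coeff_homogeneousComponent, if_pos, coeff_zero] at this
  · exact mem_support_iff.1 hd this
  · rw [totalDegree, hdeg]
    rfl

/-- A nonzero polynomial is bounded away from zero on a conical neighbourhood of a ray through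
an integral multiple of `2πi`. -/
theorem MvPolynomial.exists_le_norm_eval {n : ℕ} {Q : MvPolynomial (Fin n) ℂ} (hQ : Q ≠ 0) :
    ∃ k : Fin n → ℤ, ∃ ε > (0 : ℝ), ∃ δ > (0 : ℝ), ∀ᶠ t : ℕ in Filter.atTop,
      ∀ x ∈ Metric.ball (fun i => (t : ℂ) * (k i * (2 * Real.pi * I))) (ε * t),
        δ ≤ ‖eval x Q‖ := by
  set m := Q.totalDegree
  have hinf : (Set.range fun k : ℤ => (k : ℂ) * (2 * Real.pi * I)).Infinite := by
    refine Set.infinite_range_of_injective fun a b hab => ?_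
    exact_mod_cast mul_right_cancel₀ Complex.two_pi_I_ne_zero hab
  obtain ⟨k, hk⟩ : ∃ k : Fin n → ℤ,
      eval (fun i => (k i : ℂ) * (2 * Real.pi * I)) (homogeneousComponent m Q) ≠ 0 := by
    by_contra! hall
    refine homogeneousComponent_totalDegree_ne_zero hQ (funext_set _ (fun _ => hinf) ?_)
    intro x hx
    choose k hk using fun i => hx i trivial
    obtain rfl : (fun i => (k i : ℂ) * (2 * Real.pi * I)) = x := _root_.funext hk
    rw [map_zero]
    exact hall k
  set P : ℂ × (Fin n → ℂ) → ℂ := fun v =>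
    ∑ j ∈ Finset.range (m + 1), v.1 ^ (m - j) * eval v.2 (homogeneousComponent j Q) with hP
  have hPc : Continuous P := by
    have := fun j => (homogeneousComponent j Q).contDiff_eval.continuous
    fun_prop
  have hP0 : P (0, fun i => (k i : ℂ) * (2 * Real.pi * I)) ≠ 0 := by
    simp only [hP]
    rw [Finset.sum_range_succ, Finset.sum_eq_zero]
    · simpa using hk
    · intro j hj
      rw [Finset.mem_range] at hj
      rw [zero_pow (by omega), zero_mul]
  have hPQ : ∀ (t : ℂ) (z : Fin n → ℂ), t ≠ 0 → eval (t • z) Q = t ^ m * P (t⁻¹, z) := by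
    intro t z ht
    conv_lhs => rw [← sum_homogeneousComponent Q]
    rw [map_sum]
    simp only [hP]
    rw [Finset.mul_sum]
    refine Finset.sum_congr rfl fun j hj => ?_
    have hjm : j ≤ m := by rw [Finset.mem_range] at hj; omega
    rw [(homogeneousComponent_isHomogeneous j Q).eval_smul, ← mul_assoc, inv_pow,
      pow_sub₀ _ ht hjm, mul_inv, inv_inv, mul_inv_cancel_left₀ (pow_ne_zero _ ht)]
  obtain ⟨ε, hε, hball⟩ := Metric.eventually_nhds_iff.1
    (hPc.norm.continuousAt.eventually_const_lt (half_lt_self (norm_pos_iff.2 hP0)))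
  refine ⟨k, ε, hε, _, half_pos (norm_pos_iff.2 hP0), ?_⟩
  filter_upwards [Filter.eventually_ge_atTop 1,
    (tendsto_natCast_atTop_atTop (R := ℝ)).eventually_gt_atTop ε⁻¹] with t ht1 htε x hx
  have ht0 : (t : ℂ) ≠ 0 := by exact_mod_cast (by omega : t ≠ 0)
  have htR : (1 : ℝ) ≤ t := by exact_mod_cast ht1
  have hx' : x = (t : ℂ) • ((t : ℂ)⁻¹ • x) := by rw [smul_inv_smul₀ ht0]
  rw [hx', hPQ _ _ ht0, norm_mul, norm_pow, Complex.norm_natCast]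
  have hlt := hball (y := ((t : ℂ)⁻¹, (t : ℂ)⁻¹ • x)) (by
    rw [Prod.dist_eq, max_lt_iff]
    constructor
    · simpa using inv_lt_of_inv_lt₀ hε htε
    · rw [mem_ball_iff_norm, hx'] at hx
      have h2 : (fun i => (t : ℂ) * (k i * (2 * Real.pi * I))) =
        (t : ℂ) • fun i => (k i : ℂ) * (2 * Real.pi * I) := rfl
      rw [h2, ← smul_sub, norm_smul, Complex.norm_natCast, mul_comm] at hx
      rw [dist_eq_norm]
      exact lt_of_mul_lt_mul_right hx (by positivity))
  exact hlt.le.trans (le_mul_of_one_le_left (norm_nonneg _) (one_le_pow₀ htR))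

theorem eventually_log_growth_le {D E F ε : ℝ} (hε : 0 < ε) :
    ∀ᶠ t : ℕ in Filter.atTop, D + E * Real.log t + F ≤ ε * t := by
  have h : (fun t : ℝ => D + E * Real.log t + F) =o[Filter.atTop] (id : ℝ → ℝ) :=
    ((Asymptotics.isLittleO_const_id_atTop D).add
      (Real.isLittleO_log_id_atTop.const_mul_left E)).add (Asymptotics.isLittleO_const_id_atTop F)
  filter_upwards [(tendsto_natCast_atTop_atTop (R := ℝ)).eventually (h.def hε)] with t ht
  refine (le_abs_self _).trans (ht.trans_eq ?_)
  simp

theorem exists_norm_evalAt_le_of_finite {ι : Type} [Fintype ι] {n : ℕ}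
    {g : Polynomial (MvPolynomial (Fin n) ℂ)} (hg : g.Monic)
    (hdeg : 0 < g.natDegree) (h : ι → Polynomial (MvPolynomial (Fin n) ℂ)) :
    ∃ C : ℝ, 0 ≤ C ∧ ∃ M : ℕ, ∀ i (x : Fin n → ℂ) (T : ℂ), evalAt x T g = 0 →
      ‖evalAt x T (h i)‖ ≤ C * (1 + ‖x‖) ^ M := by
  choose C hC M hM using fun i => exists_norm_evalAt_le hg hdeg (h i)
  refine ⟨∑ i, C i, Finset.sum_nonneg fun _ _ => hC _, ∑ i, M i, fun i x T hT => ?_⟩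
  have hx : 1 ≤ 1 + ‖x‖ := by linarith [norm_nonneg x]
  refine (hM i x T hT).trans ?_
  gcongr
  · exact Finset.sum_nonneg fun _ _ => hC _
  · exact Finset.single_le_sum (f := C) (fun _ _ => hC _) (Finset.mem_univ i)
  · exact Finset.single_le_sum (fun _ _ => Nat.zero_le _) (Finset.mem_univ i)

theorem DifferentiableOn.evalAt {n : ℕ} {θ : (Fin n → ℂ) → ℂ} {s : Set (Fin n → ℂ)}
    (hθ : DifferentiableOn ℂ θ s) (h : Polynomial (MvPolynomial (Fin n) ℂ)) :
    DifferentiableOn ℂ (fun x => evalAt x (θ x) h) s := by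
  intro x hx
  have h1 := ((contDiff_evalAt h).differentiable one_ne_zero) (x, θ x)
  exact DifferentiableAt.comp_differentiableWithinAt
    (g := fun v : (Fin n → ℂ) × ℂ => _root_.evalAt v.1 v.2 h) (f := fun x => (x, θ x)) x h1
    (differentiableWithinAt_id.prodMk (hθ x hx))

/-- On the finite cover of `ℂ^n` given by the monic polynomial `g`, the system
`exp (x i) = h i / Q` has a solution, provided that `g` is separable and the functions `h i / Q`
are invertible, with inverse `k i / Q`, away from the zero set of `Q`. -/
theorem exists_exp_eq_on_cover {n : ℕ} {g : Polynomial (MvPolynomial (Fin n) ℂ)} (hg : g.Monic)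
    (hdeg : 0 < g.natDegree) {h k : Fin n → Polynomial (MvPolynomial (Fin n) ℂ)}
    {Q : MvPolynomial (Fin n) ℂ} (hQ : Q ≠ 0)
    (hsep : ∀ x T, evalAt x T g = 0 → eval x Q ≠ 0 →
      evalAt x T (Polynomial.derivative g) ≠ 0)
    (hinv : ∀ x T, evalAt x T g = 0 → ∀ i, evalAt x T (h i) * evalAt x T (k i) = eval x Q ^ 2) :
    ∃ a T, eval a Q ≠ 0 ∧ evalAt a T g = 0 ∧
      ∀ i, eval a Q * exp (a i) = evalAt a T (h i) := by
  obtain ⟨C, hC, M, hCM⟩ := exists_norm_evalAt_le_of_finite hg hdeg (Sum.elim h k)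
  obtain ⟨κ, ε, hε, δ, hδ, hlow⟩ := exists_le_norm_eval hQ
  set w : Fin n → ℂ := fun i => κ i * (2 * Real.pi * I) with hw
  set D : ℝ := 2 + C * (1 + ‖w‖ + ε) ^ M / δ with hD
  have hD2 : 2 ≤ D := le_add_of_nonneg_right (by positivity)
  obtain ⟨t, ht, ht1, htA⟩ := (hlow.and ((Filter.eventually_ge_atTop 1).and
    (eventually_log_growth_le (D := 80 * Real.log D) (E := 80 * M) (F := 48 * Real.pi) hε))).exists
  set c : Fin n → ℂ := fun i => (t : ℂ) * (κ i * (2 * Real.pi * I)) with hc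
  have htR : (1 : ℝ) ≤ t := by exact_mod_cast ht1
  have hcw : c = (t : ℂ) • w := rfl
  set R := ε * t
  have hR : 0 < R := by positivity
  have hcR := Metric.mem_ball_self (x := c) hR
  have hQ0 : ∀ x ∈ Metric.ball c R, eval x Q ≠ 0 := fun x hx => by
    rw [← norm_pos_iff]; exact hδ.trans_le (ht x hx)
  set A : ℝ := Real.log D + M * Real.log t with hA
  have hApos : 0 < A := add_pos_of_pos_of_nonneg (Real.log_pos (by linarith))
    (mul_nonneg (Nat.cast_nonneg _) (Real.log_nonneg htR))
  have hexpA : Real.exp A = D * (t : ℝ) ^ M := by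
    rw [hA, Real.exp_add, Real.exp_log (by linarith), ← Real.log_pow, Real.exp_log (by positivity)]
  have hbound : ∀ x ∈ Metric.ball c R, ∀ T, evalAt x T g = 0 → ∀ j,
      ‖evalAt x T (Sum.elim h k j) / eval x Q‖ ≤ Real.exp A := by
    intro x hx T hT j
    have hxn : 1 + ‖x‖ ≤ (1 + ‖w‖ + ε) * t := by
      have h1 : ‖c‖ = t * ‖w‖ := by rw [hcw, norm_smul, Complex.norm_natCast]
      have h2 := norm_le_norm_add_norm_sub' x c
      have h3 := mem_ball_iff_norm.1 hx
      simp only [R] at h3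
      nlinarith
    rw [norm_div, hexpA, div_le_iff₀ (norm_pos_iff.2 (hQ0 x hx))]
    calc _ ≤ C * (1 + ‖x‖) ^ M := hCM j x T hT
      _ ≤ C * ((1 + ‖w‖ + ε) * t) ^ M := by gcongr
      _ = C * (1 + ‖w‖ + ε) ^ M / δ * t ^ M * δ := by rw [mul_pow]; field_simp
      _ ≤ D * t ^ M * ‖eval x Q‖ := by
        gcongr
        · linarith
        · exact ht x hx
  obtain ⟨θ, hθd, hθ⟩ := exists_differentiableOn_root hg hdeg hR
    (fun x hx T hT => hsep x T hT (hQ0 x hx))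
  set y : Fin n → (Fin n → ℂ) → ℂ := fun i x => evalAt x (θ x) (h i) / eval x Q with hy
  have hyk : ∀ i, ∀ x ∈ Metric.ball c R, y i x * (evalAt x (θ x) (k i) / eval x Q) = 1 := by
    intro i x hx
    have h0 := hQ0 x hx
    rw [hy, div_mul_div_comm, hinv x _ (hθ x hx) i, ← sq, div_self (pow_ne_zero 2 h0)]
  have hyd : ∀ i, DifferentiableOn ℂ (y i) (Metric.ball c R) := by
    intro i
    have h1 : DifferentiableOn ℂ (fun x => evalAt x (θ x) (h i)) (Metric.ball c R) :=
      hθd.evalAt (h i)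
    have h2 := (Q.contDiff_eval.differentiable one_ne_zero).differentiableOn (s := Metric.ball c R)
    have h3 : DifferentiableOn ℂ (fun x => (eval x Q)⁻¹) (Metric.ball c R) := h2.fun_inv hQ0
    simpa only [hy, div_eq_mul_inv] using h1.fun_mul h3
  choose L hLd hLexp hLim using fun i => exists_differentiableOn_log hR (hyd i)
    (fun x hx => left_ne_zero_of_mul_eq_one (hyk i x hx))
  have hre : ∀ x ∈ Metric.ball c R, ∀ i, |(L i x).re| ≤ A := by
    intro x hx i
    rw [abs_le]
    constructor
    · rw [neg_le, ← Real.exp_le_exp, ← Complex.neg_re, ← Complex.norm_exp, Complex.exp_neg,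
        hLexp i x hx, inv_eq_of_mul_eq_one_right (hyk i x hx)]
      exact hbound x hx _ (hθ x hx) (Sum.inr i)
    · rw [← Real.exp_le_exp, ← Complex.norm_exp, hLexp i x hx]
      exact hbound x hx _ (hθ x hx) (Sum.inl i)
  obtain ⟨a, ha, hfix⟩ := exists_eq_center_add (L := fun x i => L i x) (c := c) (R := R)
    hApos (add_nonneg hApos.le Real.pi_nonneg) (differentiableOn_pi.2 hLd)
    (fun x hx i => (abs_le.1 (hre x hx i)).2)
    (fun i => (norm_le_abs_re_add_abs_im _).trans (add_le_add (hre c hcR i) (hLim i)))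
    (by simp only [R, hA]; linarith)
  refine ⟨a, θ a, hQ0 a ha, hθ a ha, fun i => ?_⟩
  have hai : a i = ((t * κ i : ℤ) : ℂ) * (2 * Real.pi * I) + L i a := by
    rw [congrFun hfix i]
    simp [hc, mul_assoc]
  have hexp : exp (a i) = y i a := by
    rw [hai, Complex.exp_add, Complex.exp_int_mul_two_pi_mul_I, one_mul, hLexp i a ha]
  rw [hexp, hy]
  exact mul_div_cancel₀ _ (hQ0 a ha)

/-- Finitely many elements algebraic over a domain of characteristic zero are, up to a common
denominator, polynomial expressions in a single integral element. -/
theorem exists_isIntegral_forall_aeval_eq {R K ι : Type} [CommRing R] [IsDomain R] [CharZero R]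
    [Field K] [Algebra R K] [FaithfulSMul R K] [Finite ι] {y : ι → K}
    (hy : ∀ i, IsAlgebraic R (y i)) :
    ∃ α : K, IsIntegral R α ∧ ∃ d : R, d ≠ 0 ∧ ∃ h : ι → Polynomial R,
      ∀ i, Polynomial.aeval α (h i) = algebraMap R K d * y i := by
  let F := FractionRing R
  let : Algebra F K := FractionRing.liftAlgebra R K
  have : IsScalarTower R F K := FractionRing.isScalarTower_liftAlgebra R K
  have : CharZero F := IsFractionRing.charZero_of_isFractionRing R
  let S := IntermediateField.adjoin F (Set.range y)
  have : FiniteDimensional F S := IntermediateField.finiteDimensional_adjoin (by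
    rintro _ ⟨i, rfl⟩
    exact ((IsFractionRing.isAlgebraic_iff R F K).1 (hy i)).isIntegral)
  let pb := Field.powerBasisOfFiniteOfSeparable F S
  have hgen : IsAlgebraic R (pb.gen : K) := by
    rw [IsFractionRing.isAlgebraic_iff R F K]
    exact (Algebra.IsAlgebraic.isAlgebraic (R := F) pb.gen).algebraMap
  obtain ⟨r, hr, hrint⟩ := hgen.exists_integral_multiple
  have hr' : algebraMap R F r ≠ 0 := by simpa using hr
  have hex : ∀ i, ∃ p : Polynomial F, Polynomial.aeval (r • (pb.gen : K)) p = y i := by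
    intro i
    obtain ⟨p, hp⟩ := pb.exists_eq_aeval' ⟨y i, IntermediateField.subset_adjoin _ _ ⟨i, rfl⟩⟩
    refine ⟨p.comp (Polynomial.C (algebraMap R F r)⁻¹ * Polynomial.X), ?_⟩
    have h1 : Polynomial.aeval (r • (pb.gen : K))
        (Polynomial.C (algebraMap R F r)⁻¹ * Polynomial.X) = pb.gen := by
      rw [map_mul, Polynomial.aeval_C, Polynomial.aeval_X, Algebra.smul_def,
        IsScalarTower.algebraMap_apply R F K, map_inv₀, inv_mul_cancel_left₀]
      simpa using hr'
    rw [Polynomial.aeval_comp, h1]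
    have h2 := congrArg (algebraMap S K) hp
    rw [← Polynomial.aeval_algebraMap_apply] at h2
    exact h2.symm
  choose p hp using hex
  choose b hb hbp using fun i => IsLocalization.integerNormalization_spec (nonZeroDivisors R) (p i)
  have := Fintype.ofFinite ι
  classical
  refine ⟨_, hrint, ∏ i, b i, Finset.prod_ne_zero_iff.2 fun i _ => nonZeroDivisors.ne_zero (hb i),
    fun i => Polynomial.C (∏ j ∈ Finset.univ.erase i, b j) *
      IsLocalization.integerNormalization (nonZeroDivisors R) (p i), fun i => ?_⟩
  have h3 := congrArg (Polynomial.aeval (r • (pb.gen : K))) (hbp i)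
  rw [Polynomial.aeval_map_algebraMap, ← algebraMap_smul F (b i) (p i), map_smul, algebraMap_smul,
    hp, Algebra.smul_def (b i)] at h3
  rw [map_mul, h3, Polynomial.aeval_C, ← mul_assoc, ← map_mul,
    Finset.prod_erase_mul _ _ (Finset.mem_univ i)]

theorem exists_aeval_derivative_minpoly_mul_eq {R K : Type} [CommRing R] [IsDomain R] [CharZero R]
    [IsIntegrallyClosed R] [Field K] [Algebra R K] [FaithfulSMul R K] {α : K}
    (hα : IsIntegral R α) :
    ∃ D : R, D ≠ 0 ∧ ∃ B : Polynomial R,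
      Polynomial.aeval α (Polynomial.derivative (minpoly R α) * B) = algebraMap R K D := by
  have hpos := minpoly.natDegree_pos hα
  have hder : Polynomial.aeval α (Polynomial.derivative (minpoly R α)) ≠ 0 := by
    intro h0
    have hne : Polynomial.derivative (minpoly R α) ≠ 0 := by
      rw [Ne, Polynomial.derivative_eq_zero]
      omega
    have h1 := minpoly.IsIntegrallyClosed.degree_le_of_ne_zero hne h0
    exact absurd (Polynomial.degree_derivative_lt (minpoly.ne_zero hα)) h1.not_gt
  let z : (Polynomial.aeval (R := R) α).range := ⟨_, Polynomial.derivative (minpoly R α), rfl⟩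
  have hz : IsAlgebraic R z := by
    have h1 : IsIntegral R (Polynomial.aeval α (Polynomial.derivative (minpoly R α))) :=
      .of_mem_of_fg _ hα.fg_adjoin_singleton _ (by exact Polynomial.aeval_mem_adjoin_singleton R α)
    have h2 : IsIntegral R z := (isIntegral_algHom_iff
      (Polynomial.aeval (R := R) α).range.val Subtype.val_injective).1 h1
    exact h2.isAlgebraic
  obtain ⟨D, hD, ⟨_, B, rfl⟩, hB⟩ := hz.exists_nonzero_dvd
    (mem_nonZeroDivisors_of_ne_zero (by simpa [z, Subtype.ext_iff] using hder))
  refine ⟨D, hD, B, ?_⟩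
  have := congrArg Subtype.val hB
  rw [map_mul]
  exact this.symm

theorem exists_numerator {n : ℕ} (Q : MvPolynomial (Fin n) ℂ)
    (h : Fin n → Polynomial (MvPolynomial (Fin n) ℂ)) (f : MvPolynomial (Fin n ⊕ Fin n) ℂ) :
    ∃ (N : ℕ) (P : Polynomial (MvPolynomial (Fin n) ℂ)), ∀ {B : Type} [CommRing B]
      (χ : Polynomial (MvPolynomial (Fin n) ℂ) →+* B) (z : Fin n → B),
      (∀ i, χ (Polynomial.C Q) * z i = χ (h i)) →
      χ P = χ (Polynomial.C Q) ^ N * eval₂ (χ.comp (Polynomial.C.comp C))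
        (Sum.elim (fun j => χ (Polynomial.C (X j))) z) f := by
  induction f using MvPolynomial.induction_on with
  | C a => exact ⟨0, Polynomial.C (C a), fun χ z _ => by simp⟩
  | add p q hp hq =>
    obtain ⟨N₁, P₁, H₁⟩ := hp
    obtain ⟨N₂, P₂, H₂⟩ := hq
    refine ⟨N₁ + N₂, Polynomial.C Q ^ N₂ * P₁ + Polynomial.C Q ^ N₁ * P₂, fun χ z hz => ?_⟩
    simp only [map_add, map_mul, map_pow, eval₂_add, H₁ χ z hz, H₂ χ z hz]
    ring
  | mul_X p i hp =>
    obtain ⟨N, P, H⟩ := hp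
    rcases i with j | i
    · refine ⟨N, P * Polynomial.C (X j), fun χ z hz => ?_⟩
      simp only [map_mul, eval₂_mul, eval₂_X, Sum.elim_inl, H χ z hz]
      ring
    · refine ⟨N + 1, P * h i, fun χ z hz => ?_⟩
      simp only [map_mul, eval₂_mul, eval₂_X, Sum.elim_inr, H χ z hz, ← hz i]
      ring

/-- A variety dominating `ℂ^n` whose last `n` coordinates are algebraic over the first `n` is
parametrised, over a nonempty Zariski open set, by the finite cover defined by a monic
polynomial. -/
theorem exists_cover {n : ℕ} {K : Type} [Field K] {φ : MvPolynomial (Fin n ⊕ Fin n) ℂ →+* K}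
    (hφ : Function.Injective (φ.comp (rename Sum.inl).toRingHom))
    (hy : ∀ i, ∃ p : Polynomial (MvPolynomial (Fin n) ℂ), p ≠ 0 ∧
      p.eval₂ (φ.comp (rename Sum.inl).toRingHom) (φ (X (Sum.inr i))) = 0)
    (hy0 : ∀ i, φ (X (Sum.inr i)) ≠ 0) {q : MvPolynomial (Fin n) ℂ} (hq : q ≠ 0) :
    ∃ (g : Polynomial (MvPolynomial (Fin n) ℂ))
      (h k : Fin n → Polynomial (MvPolynomial (Fin n) ℂ)) (Q : MvPolynomial (Fin n) ℂ),
      g.Monic ∧ 0 < g.natDegree ∧ Q ≠ 0 ∧ q ∣ Q ∧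
      (∀ x T, evalAt x T g = 0 → eval x Q ≠ 0 →
        evalAt x T (Polynomial.derivative g) ≠ 0) ∧
      (∀ x T, evalAt x T g = 0 → ∀ i, evalAt x T (h i) * evalAt x T (k i) = eval x Q ^ 2) ∧
      ∀ x T, evalAt x T g = 0 → eval x Q ≠ 0 → ∀ z : Fin n → ℂ,
        (∀ i, eval x Q * z i = evalAt x T (h i)) → ∀ f, φ f = 0 → eval (Sum.elim x z) f = 0 := by
  let : Algebra (MvPolynomial (Fin n) ℂ) K := (φ.comp (rename Sum.inl).toRingHom).toAlgebra
  have hmap : ∀ r : MvPolynomial (Fin n) ℂ, algebraMap _ K r = φ (rename Sum.inl r) := fun _ => rfl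
  have : FaithfulSMul (MvPolynomial (Fin n) ℂ) K :=
    (faithfulSMul_iff_algebraMap_injective _ _).2 hφ
  set y : Fin n → K := fun i => φ (X (Sum.inr i)) with hydef
  have halg : ∀ i, IsAlgebraic (MvPolynomial (Fin n) ℂ) (y i) := fun i => by
    obtain ⟨p, hp, hpy⟩ := hy i
    exact ⟨p, hp, hpy⟩
  obtain ⟨α, hα, d, hd, h, hh⟩ := exists_isIntegral_forall_aeval_eq
    (y := Sum.elim y fun i => (y i)⁻¹) (by rintro (i | i); exacts [halg i, (halg i).inv])
  obtain ⟨D, hD, B, hB⟩ := exists_aeval_derivative_minpoly_mul_eq hα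
  have hdvd : ∀ P : Polynomial (MvPolynomial (Fin n) ℂ), Polynomial.aeval α P = 0 →
      ∀ x T, evalAt x T (minpoly (MvPolynomial (Fin n) ℂ) α) = 0 → evalAt x T P = 0 := by
    intro P hP x T hT
    obtain ⟨P', rfl⟩ := minpoly.isIntegrallyClosed_dvd hα hP
    rw [map_mul, hT, zero_mul]
  set Q := q * D * d with hQ
  refine ⟨minpoly _ α, fun i => Polynomial.C (q * D) * h (Sum.inl i),
    fun i => Polynomial.C (q * D) * h (Sum.inr i), Q, minpoly.monic hα, minpoly.natDegree_pos hα,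
    mul_ne_zero (mul_ne_zero hq hD) hd, ⟨D * d, by rw [hQ, mul_assoc]⟩, ?_, ?_, ?_⟩
  · intro x T hT hx h0
    have h1 := hdvd (Polynomial.derivative (minpoly _ α) * B - Polynomial.C D)
      (by rw [map_sub, hB, Polynomial.aeval_C, sub_self]) x T hT
    rw [map_sub, map_mul, h0, zero_mul, zero_sub, neg_eq_zero, evalAt_C] at h1
    exact hx (by rw [hQ, map_mul, map_mul, h1, mul_zero, zero_mul])
  · intro x T hT i
    have h1 := hdvd (Polynomial.C (q * D) * h (Sum.inl i) * (Polynomial.C (q * D) * h (Sum.inr i)) -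
      Polynomial.C Q ^ 2) (by
        simp only [map_sub, map_mul, map_pow, hh, Polynomial.aeval_C, Sum.elim_inl, Sum.elim_inr,
          hQ]
        linear_combination (algebraMap _ K q * algebraMap _ K D * algebraMap _ K d) ^ 2 *
          mul_inv_cancel₀ (hy0 i)) x T hT
    rw [map_sub, map_mul, sub_eq_zero, map_pow, evalAt_C] at h1
    exact h1
  · intro x T hT hx z hz f hf
    obtain ⟨N, P, hP⟩ := exists_numerator Q (fun i => Polynomial.C (q * D) * h (Sum.inl i)) f
    have h1 := hP (Polynomial.aeval α : Polynomial (MvPolynomial (Fin n) ℂ) →ₐ[_] K).toRingHom y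
      (fun i => by simp [hh, hQ, mul_assoc])
    have h2 : eval₂Hom ((Polynomial.aeval α :
        Polynomial (MvPolynomial (Fin n) ℂ) →ₐ[_] K).toRingHom.comp (Polynomial.C.comp C))
        (Sum.elim (fun j => (Polynomial.aeval α :
        Polynomial (MvPolynomial (Fin n) ℂ) →ₐ[_] K).toRingHom (Polynomial.C (X j))) y) = φ := by
      ext i
      · simp [hmap]
      · rcases i with j | i
        · simp [hmap]
        · simp [hydef]
    rw [← coe_eval₂Hom, h2, hf, mul_zero] at h1
    have h3 := hdvd P h1 x T hT
    rw [hP (evalAt x T) z (fun i => by rw [evalAt_C, hz i])] at h3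
    rw [evalAt_C] at h3
    have h4 := (mul_eq_zero.1 h3).resolve_left (pow_ne_zero _ hx)
    have h5 : (evalAt x T).comp (Polynomial.C.comp C) = RingHom.id ℂ := by
      ext; simp
    simp only [h5, evalAt_C, eval_X] at h4
    exact h4

theorem isZClosed_zeroSet {σ : Type} (T : Set (MvPolynomial σ ℂ)) : IsZClosed (zeroSet T) :=
  ⟨T, rfl⟩

theorem IsZIrreducible.isPrime_vanishingIdeal {σ : Type} {V : Set (σ → ℂ)} (hV : IsZIrreducible V) :
    (vanishingIdeal ℂ V).IsPrime := by
  obtain ⟨⟨v, hv⟩, hirr⟩ := hV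
  refine ⟨fun h => ?_, fun {f g} hfg => ?_⟩
  · have h1 := mem_vanishingIdeal_iff.1 ((Ideal.eq_top_iff_one _).1 h) v hv
    simp at h1
  · have hsub : V ⊆ zeroSet {f} ∪ zeroSet {g} := by
      intro x hx
      have h1 := mem_vanishingIdeal_iff.1 hfg x hx
      rw [map_mul, mul_eq_zero] at h1
      simpa [zeroSet, aeval_eq_eval] using h1
    refine (hirr _ _ (isZClosed_zeroSet _) (isZClosed_zeroSet _) hsub).imp ?_ ?_ <;>
    · intro h
      refine mem_vanishingIdeal_iff.2 fun x hx => ?_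
      simpa [zeroSet, aeval_eq_eval] using h hx

/-- An irreducible component of `S` is cut out in `S` by the polynomials vanishing on it. -/
theorem mem_of_forall_eval_eq_zero {σ : Type} {S V : Set (σ → ℂ)} (hVS : V ⊆ S)
    (hVirr : IsZIrreducible V) (hVmax : ∀ W, W ⊆ S → IsZIrreducible W → V ⊆ W → W = V)
    {v : σ → ℂ} (hvS : v ∈ S) (hv : ∀ f, (∀ x ∈ V, eval x f = 0) → eval v f = 0) : v ∈ V := by
  set W : Set (σ → ℂ) := {x ∈ S | ∀ f, (∀ x ∈ V, eval x f = 0) → eval x f = 0} with hW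
  have hVW : V ⊆ W := fun x hx => ⟨hVS hx, fun f hf => hf x hx⟩
  have hclosed : ∀ c, IsZClosed c → V ⊆ c → W ⊆ c := by
    rintro _ ⟨T, rfl⟩ hVc x hx f hf
    exact hx.2 f fun x hx => hVc hx f hf
  have hWirr : IsZIrreducible W := by
    refine ⟨hVirr.1.mono hVW, fun c₁ c₂ h₁ h₂ hc => ?_⟩
    exact (hVirr.2 c₁ c₂ h₁ h₂ (hVW.trans hc)).imp (hclosed c₁ h₁) (hclosed c₂ h₂)
  rw [← hVmax W (fun x hx => hx.1) hWirr hVW]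
  exact ⟨hvS, hv⟩

/-- if `V` is an irreducible component of
`{(x̄,ȳ) ∈ ℂ^n × (ℂ*)^n : pᵢ(x̄,yᵢ) = 0, i = 1,…,n}` for nonzero irreducible
polynomials `pᵢ(x̄,u)` of degree `≥ 1` in `u`, not of the form `c·u`, and the
projection of `V` to the first `n` coordinates is Zariski dense in `ℂ^n`, then
`{ā : (ā, e^ā) ∈ V}` is Zariski dense in `ℂ^n`.  (The variable `u` is `none`,
the variables `x₁,…,xₙ` are `some j`.) -/
theorem exp_points_dense_of_poly_system (n : ℕ) (hn : 1 ≤ n)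
    (p : Fin n → MvPolynomial (Option (Fin n)) ℂ)
    (hp0 : ∀ i, p i ≠ 0)
    (hpirr : ∀ i, Irreducible (p i))
    (hpdeg : ∀ i, 1 ≤ (p i).degreeOf none)
    (hpform : ∀ i, ∀ c : ℂ, p i ≠ C c * X none)
    (S : Set (Fin n ⊕ Fin n → ℂ))
    (hS : S = {v | (∀ i, v (Sum.inr i) ≠ 0) ∧
      ∀ i, eval (fun o => Option.elim o (v (Sum.inr i)) (fun j => v (Sum.inl j))) (p i) = 0})
    (V : Set (Fin n ⊕ Fin n → ℂ))
    -- `V` is an irreducible component of `S`: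
    (hVS : V ⊆ S) (hVirr : IsZIrreducible V)
    (hVmax : ∀ W, W ⊆ S → IsZIrreducible W → V ⊆ W → W = V)
    (hdom : IsZDense {x : Fin n → ℂ | ∃ v ∈ V, x = fun i => v (Sum.inl i)}) :
    IsZDense {a : Fin n → ℂ | Sum.elim a (fun i => exp (a i)) ∈ V} := by
  intro q hqvan
  by_contra hq
  have hprime := hVirr.isPrime_vanishingIdeal
  set φ : MvPolynomial (Fin n ⊕ Fin n) ℂ →+* FractionRing
      (MvPolynomial (Fin n ⊕ Fin n) ℂ ⧸ vanishingIdeal ℂ V) :=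
    (algebraMap _ _).comp (Ideal.Quotient.mk (vanishingIdeal ℂ V)) with hφdef
  have hφ : ∀ f, φ f = 0 ↔ ∀ v ∈ V, eval v f = 0 := by
    intro f
    rw [hφdef, RingHom.comp_apply, FaithfulSMul.algebraMap_eq_zero_iff,
      Ideal.Quotient.eq_zero_iff_mem, mem_vanishingIdeal_iff]
    simp only [aeval_eq_eval]
  have hp : ∀ i, φ (rename (fun o : Option (Fin n) => o.elim (Sum.inr i) Sum.inl) (p i)) = 0 := by
    intro i
    refine (hφ _).2 fun v hv => ?_
    have h1 := hVS hv
    rw [hS] at h1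
    rw [eval_rename, ← h1.2 i]
    congr 2
    ext o
    cases o <;> rfl
  obtain ⟨g, h, k, Q, hg, hdeg, hQ, hqQ, hsep, hinv, hvan⟩ := exists_cover (φ := φ)
    ((injective_iff_map_eq_zero _).2 fun f hf => hdom f (by
      rintro _ ⟨v, hv, rfl⟩
      have h1 := (hφ _).1 hf v hv
      rwa [AlgHom.toRingHom_eq_coe, RingHom.coe_coe, eval_rename] at h1))
    (fun i => by
      refine ⟨optionEquivLeft ℂ (Fin n) (p i), by simpa using hp0 i, ?_⟩
      have h1 : (Polynomial.eval₂RingHom (φ.comp (rename Sum.inl).toRingHom)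
          (φ (X (Sum.inr i)))).comp (optionEquivLeft ℂ (Fin n)).toRingEquiv.toRingHom =
          φ.comp (rename fun o : Option (Fin n) => o.elim (Sum.inr i) Sum.inl).toRingHom := by
        ext o
        · simp [optionEquivLeft_C]
        · cases o <;> simp
      exact (congrArg (· (p i)) h1).trans (hp i))
    (fun i hi => by
      obtain ⟨v, hv⟩ := hVirr.1
      have h1 := hVS hv
      rw [hS] at h1
      exact h1.1 i (by simpa using (hφ _).1 hi v hv)) hq
  obtain ⟨a, T, hQa, hgT, hexp⟩ := exists_exp_eq_on_cover hg hdeg hQ hsep hinv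
  have hzero : ∀ f, φ f = 0 → eval (Sum.elim a fun i => exp (a i)) f = 0 :=
    hvan a T hgT hQa _ hexp
  have haV : (Sum.elim a fun i => exp (a i)) ∈ V := by
    refine mem_of_forall_eval_eq_zero hVS hVirr hVmax ?_ fun f hf => hzero f ((hφ f).2 hf)
    rw [hS]
    refine ⟨fun i => exp_ne_zero _, fun i => ?_⟩
    have h1 := hzero _ (hp i)
    rw [eval_rename] at h1
    rw [← h1]
    congr 2
    ext o
    cases o <;> rfl
  obtain ⟨Q', rfl⟩ := hqQ
  exact hQa (by rw [map_mul, hqvan a haV, zero_mul])
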